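/- Existence of a transfer path: let π and π' be two non-redundant allocations whose bundles partition G, and let x ∈ L be an agent with |π(x)| < |π'(x)|. Then there exists an agent y ∈ L with |π(y)| > |π'(y)| and a sequence of items g_1, …, g_t (t ≥ 1) such that g_1 ∈ F_x(π), g_t ∈ π(y), and for each k < t there is an arc from g_k to g_{k+1} in the exchange graph G(π). -/

import Mathlib

open scoped Classical

/-- A set function `u` on subsets of the finite ground set `I` (the set of items `G`)
is a *matroid rank function* (MRF). -/
def IsMRF {I : Type*} [DecidableEq I] (u : Finset I → ℕ) : Prop :=
  u ∅ = 0 ∧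
  (∀ S T : Finset I, S ⊆ T → u S ≤ u T) ∧
  (∀ S T : Finset I, S ⊆ T → ∀ g ∉ T, u (T ∪ {g}) + u S ≤ u (S ∪ {g}) + u T) ∧
  ∀ (S : Finset I) (g : I), g ∉ S → u S ≤ u (S ∪ {g}) ∧ u (S ∪ {g}) ≤ u S + 1

/-- There is an arc from `g` to `g'` in the exchange graph `G(π)`: the owner `x` of `g`
differs from the owner `y` of `g'`, and `x` is indifferent between `g` and `g'` given
its bundle, i.e. `u x ((π x \ {g}) ∪ {g'}) = u x (π x)`. -/
def ExchangeArc {I L : Type*} [DecidableEq I] (u : L → Finset I → ℕ)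
    (π : L → Finset I) (g g' : I) : Prop :=
  ∃ x y : L, x ≠ y ∧ g ∈ π x ∧ g' ∈ π y ∧ u x ((π x \ {g}) ∪ {g'}) = u x (π x)

/-- `F_x(π)`: the set of items for which agent `x` has a strictly positive marginal
gain given its bundle `π x`. -/
def Fgain {I L : Type*} [DecidableEq I] (u : L → Finset I → ℕ)
    (π : L → Finset I) (x : L) : Set I :=
  {g | u x (π x ∪ {g}) = u x (π x) + 1}

namespace IsMRF

variable {I : Type*} [DecidableEq I] {u : Finset I → ℕ}

theorem mono (h : IsMRF u) {S T : Finset I} (hST : S ⊆ T) : u S ≤ u T :=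
  h.2.1 S T hST

theorem union_singleton_le (h : IsMRF u) (S : Finset I) (g : I) : u (S ∪ {g}) ≤ u S + 1 := by
  by_cases hg : g ∈ S
  · rw [Finset.union_eq_left.2 (Finset.singleton_subset_iff.2 hg)]
    omega
  · exact (h.2.2.2 S g hg).2

theorem union_le_add_card (h : IsMRF u) (S T : Finset I) : u (S ∪ T) ≤ u S + T.card := by
  induction T using Finset.induction_on with
  | empty => simp
  | insert a T ha ih =>
    have h1 := h.union_singleton_le (S ∪ T) a
    rw [Finset.card_insert_of_notMem ha, Finset.insert_eq, Finset.union_comm {a} T,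
      ← Finset.union_assoc]
    omega

theorem le_card (h : IsMRF u) (S : Finset I) : u S ≤ S.card := by
  have h1 := h.union_le_add_card ∅ S
  rwa [Finset.empty_union, h.1, zero_add] at h1

/-- Subsets of independent sets are independent. -/
theorem eq_card_of_subset (h : IsMRF u) {A B : Finset I} (hA : u A = A.card) (hBA : B ⊆ A) :
    u B = B.card := by
  have h1 := h.union_le_add_card B (A \ B)
  rw [Finset.union_sdiff_of_subset hBA, hA] at h1
  have h2 := Finset.card_sdiff_add_card_eq_card hBA
  have h3 := h.le_card B
  omega

/-- An item that adds nothing to a set adds nothing to any larger set. -/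
theorem union_singleton_eq_of_subset (h : IsMRF u) {S T : Finset I} (hST : S ⊆ T) {g : I}
    (hg : u (S ∪ {g}) = u S) : u (T ∪ {g}) = u T := by
  by_cases hgT : g ∈ T
  · rw [Finset.union_eq_left.2 (Finset.singleton_subset_iff.2 hgT)]
  · have h1 := h.2.2.1 S T hST g hgT
    have h2 := h.mono (Finset.subset_union_left : T ⊆ T ∪ {g})
    omega

theorem union_eq_of_forall (h : IsMRF u) (S T : Finset I) (hT : ∀ g ∈ T, u (S ∪ {g}) = u S) :
    u (S ∪ T) = u S := by
  induction T using Finset.induction_on with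
  | empty => simp
  | insert a T ha ih =>
    rw [Finset.insert_eq, Finset.union_comm {a} T, ← Finset.union_assoc,
      h.union_singleton_eq_of_subset Finset.subset_union_left (hT a (Finset.mem_insert_self a T))]
    exact ih fun g hg => hT g (Finset.mem_insert_of_mem hg)

/-- Matroid augmentation. -/
theorem exists_augment (h : IsMRF u) {S T : Finset I} (hST : u S < u T) :
    ∃ g ∈ T, u (S ∪ {g}) = u S + 1 := by
  by_contra! hne
  have h1 := h.union_eq_of_forall S T fun g hg => by
    have h2 := hne g hg
    have h3 := h.union_singleton_le S g
    have h4 := h.mono (Finset.subset_union_left : S ⊆ S ∪ {g})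
    omega
  have h2 := h.mono (Finset.subset_union_right : T ⊆ S ∪ T)
  omega

/-- If `g'` is independent of `A \ D`, then it can be exchanged for some item of `D`. -/
theorem exists_exchange (h : IsMRF u) {A : Finset I} (hA : u A = A.card) {g' : I}
    (D : Finset I) (hDA : D ⊆ A) (hD : D.Nonempty)
    (hind : u ((A \ D) ∪ {g'}) = (A \ D).card + 1) :
    ∃ g ∈ D, u ((A \ {g}) ∪ {g'}) = u A := by
  induction hD using Finset.Nonempty.cons_induction with
  | singleton d =>
    refine ⟨d, Finset.mem_singleton_self d, ?_⟩
    have h1 := Finset.card_sdiff_add_card_eq_card hDA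
    rw [Finset.card_singleton] at h1
    omega
  | cons d D hd hD ih =>
    have hdA : d ∈ A := hDA (Finset.mem_cons_self d D)
    have hDA' : D ⊆ A := (Finset.subset_cons hd).trans hDA
    have hset : (A \ Finset.cons d D hd) ∪ {g'} ∪ {d} = (A \ D) ∪ {g'} := by
      ext i
      simp only [Finset.mem_union, Finset.mem_sdiff, Finset.mem_cons, Finset.mem_singleton]
      by_cases hi : i = d
      · subst hi; simp [hd, hdA]
      · simp [hi]
    have hcard : (A \ D).card = (A \ Finset.cons d D hd).card + 1 := by
      have h1 := Finset.card_sdiff_add_card_eq_card hDA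
      have h2 := Finset.card_sdiff_add_card_eq_card hDA'
      rw [Finset.card_cons] at h1
      omega
    by_cases hD' : u ((A \ D) ∪ {g'}) = (A \ D).card + 1
    · obtain ⟨g, hg, hgu⟩ := ih hDA' hD'
      exact ⟨g, Finset.mem_cons_of_mem hg, hgu⟩
    · refine ⟨d, Finset.mem_cons_self d D, ?_⟩
      have hzero : u ((A \ Finset.cons d D hd) ∪ {g'} ∪ {d})
          = u ((A \ Finset.cons d D hd) ∪ {g'}) := by
        have h1 := h.mono
          (Finset.subset_union_left (s₁ := (A \ Finset.cons d D hd) ∪ {g'}) (s₂ := {d}))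
        have h2 := h.union_singleton_le ((A \ Finset.cons d D hd) ∪ {g'}) d
        rw [hset] at h1 h2 ⊢
        omega
      have hsub : (A \ Finset.cons d D hd) ∪ {g'} ⊆ (A \ {d}) ∪ {g'} :=
        Finset.union_subset_union_left (Finset.sdiff_subset_sdiff subset_rfl (by simp))
      have h3 := h.union_singleton_eq_of_subset hsub hzero
      have h4 : u A ≤ u ((A \ {d}) ∪ {g'} ∪ {d}) := h.mono fun i hi => by
        by_cases hid : i = d <;> simp [hi, hid]
      have h5 := h.le_card ((A \ {d}) ∪ {g'})
      have h6 := Finset.card_union_le (A \ {d}) {g'}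
      have h7 := Finset.card_sdiff_add_card_eq_card (Finset.singleton_subset_iff.2 hdA)
      rw [Finset.card_singleton] at h6 h7
      omega

/-- If the independent set `C` has more items outside `R` than the independent set `A`, then some
item of `C` outside `R` extends `A` (when `A` misses `R`), or can be exchanged for an item of `A`
in `R`. -/
theorem exists_gain_or_exchange (h : IsMRF u) {A C R : Finset I} (hA : u A = A.card)
    (hC : u C = C.card) (hlt : (A \ R).card < (C \ R).card) :
    ∃ g' ∈ C, g' ∉ R ∧ g' ∉ A ∧
      ((A ∩ R = ∅ ∧ u (A ∪ {g'}) = u A + 1) ∨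
        ∃ g ∈ A, g ∈ R ∧ u ((A \ {g}) ∪ {g'}) = u A) := by
  have hAR := h.eq_card_of_subset hA (Finset.sdiff_subset : A \ R ⊆ A)
  have hCR := h.eq_card_of_subset hC (Finset.sdiff_subset : C \ R ⊆ C)
  obtain ⟨g', hg', hu⟩ := h.exists_augment (by omega : u (A \ R) < u (C \ R))
  obtain ⟨hg'C, hg'R⟩ := Finset.mem_sdiff.1 hg'
  have hg'A : g' ∉ A := fun hmem => by
    rw [Finset.union_eq_left.2
      (Finset.singleton_subset_iff.2 (Finset.mem_sdiff.2 ⟨hmem, hg'R⟩))] at hu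
    omega
  refine ⟨g', hg'C, hg'R, hg'A, ?_⟩
  rcases (A ∩ R).eq_empty_or_nonempty with hempty | hne
  · left
    rw [Finset.sdiff_eq_self_of_disjoint (Finset.disjoint_iff_inter_eq_empty.2 hempty)] at hu
    exact ⟨hempty, hu⟩
  · right
    have hind : u ((A \ (A ∩ R)) ∪ {g'}) = (A \ (A ∩ R)).card + 1 := by
      rw [Finset.sdiff_inter_self_left, hu, hAR]
    obtain ⟨g, hg, hgu⟩ := h.exists_exchange hA (A ∩ R) Finset.inter_subset_left hne hind
    exact ⟨g, (Finset.mem_inter.1 hg).1, (Finset.mem_inter.1 hg).2, hgu⟩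

end IsMRF

theorem Relation.ReflTransGen.exists_seq {α : Type*} {r : α → α → Prop} {a b : α}
    (h : Relation.ReflTransGen r a b) :
    ∃ (n : ℕ) (f : ℕ → α), f 0 = a ∧ f n = b ∧ ∀ k < n, r (f k) (f (k + 1)) := by
  induction h with
  | refl => exact ⟨0, fun _ => a, rfl, rfl, by simp⟩
  | @tail b c _ hbc ih =>
    obtain ⟨n, f, h0, hn, hf⟩ := ih
    refine ⟨n + 1, fun k => if k ≤ n then f k else c, by simpa, by simp, fun k hk => ?_⟩
    rcases (Nat.lt_succ_iff_lt_or_eq.1 hk) with hlt | rfl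
    · simpa [hlt.le, Nat.succ_le_of_lt hlt] using hf k hlt
    · simpa [hn] using hbc

/-- In a partition of the items into bundles, the parts of the bundles inside `R` have total
size `R.card`. -/
theorem Finset.sum_card_inter_of_partition {I L : Type*} [Fintype I] [DecidableEq I] [Fintype L]
    {π : L → Finset I} (hdisj : ∀ z z' : L, z ≠ z' → Disjoint (π z) (π z'))
    (hcov : Finset.univ.biUnion π = (Finset.univ : Finset I)) (R : Finset I) :
    ∑ z, (π z ∩ R).card = R.card := by
  rw [← Finset.card_biUnion fun z _ z' _ hz =>
    (hdisj z z' hz).mono Finset.inter_subset_left Finset.inter_subset_left,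
    ← Finset.biUnion_inter, hcov, Finset.univ_inter]

/-- existence of a transfer path.  Let `π` and `π'` be two non-redundant
allocations whose bundles partition `G`, and let `x` be an agent with
`|π(x)| < |π'(x)|`.  Then there is an agent `y` with `|π(y)| > |π'(y)|` and a sequence
of items `g_1, …, g_t` (`t ≥ 1`, indexed here from `0` to `t-1`) with `g_1 ∈ F_x(π)`,
`g_t ∈ π(y)`, and consecutive items joined by arcs of the exchange graph `G(π)`. -/
theorem transfer_path_exists {I L : Type*} [Fintype I] [DecidableEq I]
    [Fintype L] [DecidableEq L] [Nonempty L]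
    (u : L → Finset I → ℕ) (hu : ∀ z, IsMRF (u z))
    (π π' : L → Finset I)
    (hπdisj : ∀ z z' : L, z ≠ z' → Disjoint (π z) (π z'))
    (hπcov : Finset.univ.biUnion π = (Finset.univ : Finset I))
    (hπ'disj : ∀ z z' : L, z ≠ z' → Disjoint (π' z) (π' z'))
    (hπ'cov : Finset.univ.biUnion π' = (Finset.univ : Finset I))
    (hπnr : ∀ z : L, u z (π z) = (π z).card)
    (hπ'nr : ∀ z : L, u z (π' z) = (π' z).card)
    (x : L) (hx : (π x).card < (π' x).card) :
    ∃ y : L, (π' y).card < (π y).card ∧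
      ∃ (t : ℕ) (gs : ℕ → I), 1 ≤ t ∧
        gs 0 ∈ Fgain u π x ∧ gs (t - 1) ∈ π y ∧
        ∀ k : ℕ, k + 1 < t → ExchangeArc u π (gs k) (gs (k + 1)) := by
  obtain ⟨R, hR⟩ : ∃ R : Finset I, ∀ g, g ∈ R ↔
      ∃ a ∈ Fgain u π x, Relation.ReflTransGen (ExchangeArc u π) a g :=
    ⟨Finset.univ.filter fun g =>
      ∃ a ∈ Fgain u π x, Relation.ReflTransGen (ExchangeArc u π) a g, by simp⟩
  have hclosed : ∀ z, ∀ g ∈ π z, g ∈ R → ∀ g' ∉ π z,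
      u z ((π z \ {g}) ∪ {g'}) = u z (π z) → g' ∈ R := by
    intro z g hg hgR g' hg' hgu
    obtain ⟨w, -, hw⟩ := Finset.mem_biUnion.1 (hπcov.symm ▸ Finset.mem_univ g')
    obtain ⟨a, ha, hag⟩ := (hR g).1 hgR
    refine (hR g').2 ⟨a, ha, hag.tail ⟨z, w, ?_, hg, hw, hgu⟩⟩
    rintro rfl
    exact hg' hw
  have hsplit : ∀ A : Finset I, (A ∩ R).card + (A \ R).card = A.card := fun A =>
    Finset.card_inter_add_card_sdiff A R
  have hout : (π' x \ R).card ≤ (π x \ R).card := by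
    by_contra! hlt
    obtain ⟨g', -, hg'R, hg'A, ⟨-, hgain⟩ | ⟨g, hg, hgR, hgu⟩⟩ :=
      (hu x).exists_gain_or_exchange (hπnr x) (hπ'nr x) hlt
    · exact hg'R ((hR g').2 ⟨g', hgain, .refl⟩)
    · exact hg'R (hclosed x g hg hgR g' hg'A hgu)
  obtain ⟨y, hy⟩ : ∃ y, (π' y ∩ R).card < (π y ∩ R).card := by
    by_contra! hle
    have hlt : ∑ z, (π z ∩ R).card < ∑ z, (π' z ∩ R).card :=
      Finset.sum_lt_sum (fun z _ => hle z) ⟨x, Finset.mem_univ x, by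
        have h1 := hsplit (π x)
        have h2 := hsplit (π' x)
        omega⟩
    rw [Finset.sum_card_inter_of_partition hπdisj hπcov,
      Finset.sum_card_inter_of_partition hπ'disj hπ'cov] at hlt
    exact lt_irrefl _ hlt
  obtain ⟨g, hg⟩ : (π y ∩ R).Nonempty := Finset.card_pos.1 (by omega)
  refine ⟨y, ?_, ?_⟩
  · by_contra! hle
    have hlt : (π y \ R).card < (π' y \ R).card := by
      have h1 := hsplit (π y)
      have h2 := hsplit (π' y)
      omega
    obtain ⟨g', -, hg'R, hg'A, ⟨hempty, -⟩ | ⟨d, hd, hdR, hdu⟩⟩ :=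
      (hu y).exists_gain_or_exchange (hπnr y) (hπ'nr y) hlt
    · exact Finset.ne_empty_of_mem hg hempty
    · exact hg'R (hclosed y d hd hdR g' hg'A hdu)
  · obtain ⟨hgy, hgR⟩ := Finset.mem_inter.1 hg
    obtain ⟨a, ha, hag⟩ := (hR g).1 hgR
    obtain ⟨n, f, h0, hn, hf⟩ := hag.exists_seq
    refine ⟨n + 1, f, by omega, h0 ▸ ha, ?_, fun k hk => hf k (by omega)⟩
    rwa [Nat.add_sub_cancel, hn]
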